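/- Let X be a nonempty topological space and let M be a normed additive commutative group (with the metric d_M(a,b) = ‖a − b‖, which is translation-invariant). Suppose (f_n) is a sequence of bounded continuous functions X → M, f : X → M is bounded, and D(f_n, f) → 0 as n → ∞. Then there exist a continuous function g : X → M and an element m₀ ∈ M such that f(x) = m₀ + g(x) for all x ∈ X. (That is, the set of classes of continuous bounded functions is closed in the quotient by the pseudometric D.) -/

import Mathlib

/-- The diameter pseudometric `D(f,g) = sup_{x,x'} dist (f x + g x') (f x' + g x)`. -/
noncomputable def DDist {X M : Type*} [NormedAddCommGroup M]
    (f g : X → M) : ℝ :=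
  sSup {r | ∃ x x' : X, r = dist (f x + g x') (f x' + g x)}

theorem dist_add_le_DDist {X M : Type*} [NormedAddCommGroup M] {f g : X → M}
    (hf : Bornology.IsBounded (Set.range f)) (hg : Bornology.IsBounded (Set.range g))
    (x x' : X) : dist (f x + g x') (f x' + g x) ≤ DDist f g := by
  refine le_csSup ?_ ⟨x, x', rfl⟩
  obtain ⟨C, hC⟩ := Metric.isBounded_range_iff.1 hf
  obtain ⟨K, hK⟩ := Metric.isBounded_range_iff.1 hg
  refine ⟨C + K, ?_⟩
  rintro _ ⟨y, y', rfl⟩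
  exact (dist_add_add_le _ _ _ _).trans (add_le_add (hC y y') (hK y' y))

theorem tendstoUniformly_sub_of_tendsto_DDist {X M : Type*} [NormedAddCommGroup M]
    {fn : ℕ → X → M} (hfn : ∀ n, Bornology.IsBounded (Set.range (fn n)))
    {f : X → M} (hf : Bornology.IsBounded (Set.range f))
    (h : Filter.Tendsto (fun n => DDist (fn n) f) Filter.atTop (nhds 0)) (x₀ : X) :
    TendstoUniformly (fun n x => fn n x - fn n x₀) (fun x => f x - f x₀) Filter.atTop := by
  refine Metric.tendstoUniformly_iff.2 fun ε hε => ?_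
  filter_upwards [h.eventually_lt_const hε] with n hn x
  refine lt_of_eq_of_lt ?_ ((dist_add_le_DDist (hfn n) hf x x₀).trans_lt hn)
  rw [dist_comm, dist_eq_norm, dist_eq_norm]
  congr 1
  abel

theorem stmt_9 {X M : Type*} [TopologicalSpace X] [Nonempty X]
    [NormedAddCommGroup M]
    (fn : ℕ → X → M)
    (hfn_cont : ∀ n, Continuous (fn n))
    (hfn_bdd : ∀ n, Bornology.IsBounded (Set.range (fn n)))
    (f : X → M) (hf : Bornology.IsBounded (Set.range f))
    (hconv : Filter.Tendsto (fun n => DDist (fn n) f) Filter.atTop (nhds 0)) :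
    ∃ (g : X → M) (m₀ : M), Continuous g ∧ ∀ x, f x = m₀ + g x := by
  obtain ⟨x₀⟩ := ‹Nonempty X›
  refine ⟨fun x => f x - f x₀, f x₀, ?_, fun x => (add_sub_cancel _ _).symm⟩
  exact (tendstoUniformly_sub_of_tendsto_DDist hfn_bdd hf hconv x₀).continuous
    (Filter.Frequently.of_forall fun n => (hfn_cont n).sub continuous_const)
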